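/- Let A = (Q, Σ, δ, F) be an NTA(NFA) and for q ∈ Q, σ ∈ Σ let m_{q,σ} be the number of states of the NFA H^A_{q,σ} recognizing δ(q,σ). Then there exists a DTA(DFA) B equivalent to A with at most 2^{|Q|} vertical states and at most 2^{|Q|} · (Σ_{σ∈Σ} 2^{(Σ_{q∈Q} m_{q,σ})}) horizontal states. -/

import Mathlib

/-- Unranked trees over alphabet `α`: a node label together with a finite ordered
list of subtrees. -/
inductive UTree (α : Type) : Type where
  | node : α → List (UTree α) → UTree α

/-- Bottom-up reachability: `TReach δ t q` holds iff state `q` can be reached at the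
root of tree `t` using the horizontal languages `δ`. -/
inductive TReach {α Q : Type} (δ : Q → α → Set (List Q)) : UTree α → Q → Prop where
  | node {a : α} {ts : List (UTree α)} {qs : List Q} {q : Q}
      (hlen : ts.length = qs.length)
      (hchild : ∀ i : Fin ts.length, TReach δ (ts.get i) (qs.get (Fin.cast hlen i)))
      (hq : qs ∈ δ q a) : TReach δ (UTree.node a ts) q

/-- The tree language defined by transitions `δ` and final states `F`. -/
def TLang {α Q : Type} (δ : Q → α → Set (List Q)) (F : Set Q) : Set (UTree α) :=
  {t | ∃ q ∈ F, TReach δ t q}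

/-- Contexts: unranked trees with exactly one leaf occurrence of a hole (the variable `x`). -/
inductive UCtx (α : Type) : Type where
  | hole : UCtx α
  | node : α → List (UTree α) → UCtx α → List (UTree α) → UCtx α

/-- Substituting a tree for the hole of a context. -/
def UCtx.subst {α : Type} : UCtx α → UTree α → UTree α
  | .hole, t => t
  | .node a l c r, t => UTree.node a (l ++ c.subst t :: r)

/-- Determinism of a tree automaton: the horizontal languages of distinct
vertical states are disjoint. -/
def IsDet {α Q R : Type} (δ : Q → α → Set (List R)) : Prop :=
  ∀ (a : α) (q₁ q₂ : Q), q₁ ≠ q₂ → δ q₁ a ∩ δ q₂ a = ∅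

/-! ### Plain (no leaf convention) models -/

/-- A strongly deterministic unranked tree automaton (SDTA): for each symbol `a` a
single complete DFA over the alphabet of vertical states, with final states `hacc a`
and output function `out a`. -/
structure SDTA (α : Type) where
  Q : Type
  [finQ : Fintype Q]
  S : α → Type
  [finS : ∀ a, Fintype (S a)]
  start : ∀ a : α, S a
  step : ∀ a : α, S a → Q → S a
  hacc : ∀ a : α, Set (S a)
  out : ∀ a : α, S a → Q
  F : Set Q

attribute [instance] SDTA.finQ SDTA.finS

namespace SDTA
variable {α : Type} (A : SDTA α)

/-- Horizontal language `δ(q,a)` of an SDTA. -/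
def hLang (q : A.Q) (a : α) : Set (List A.Q) :=
  {w | w.foldl (A.step a) (A.start a) ∈ A.hacc a ∧
       A.out a (w.foldl (A.step a) (A.start a)) = q}

/-- The tree language recognized by an SDTA. -/
def lang : Set (UTree α) := TLang A.hLang A.F

/-- Number of vertical states. -/
def vcard : ℕ := Fintype.card A.Q

/-- Number of horizontal states: `Σ_{σ∈Σ} |S_σ|`. -/
def hcard [Fintype α] : ℕ := ∑ a : α, Fintype.card (A.S a)

end SDTA

/-- An NTA(NFA): an unranked tree automaton whose horizontal language for each
vertical state `q` and symbol `a` is given by an NFA over the alphabet of vertical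
states. -/
structure NTAN (α : Type) where
  Q : Type
  [finQ : Fintype Q]
  S : Q → α → Type
  [finS : ∀ q a, Fintype (S q a)]
  H : ∀ (q : Q) (a : α), NFA Q (S q a)
  F : Set Q

attribute [instance] NTAN.finQ NTAN.finS

namespace NTAN
variable {α : Type} (A : NTAN α)

/-- Horizontal language `δ(q,a)`. -/
def hLang (q : A.Q) (a : α) : Set (List A.Q) := (A.H q a).accepts

/-- The tree language recognized. -/
def lang : Set (UTree α) := TLang A.hLang A.F

/-- Number of vertical states. -/
def vcard : ℕ := Fintype.card A.Q

/-- Number of horizontal states: `Σ_{q∈Q,σ∈Σ} |S_{q,σ}|`. -/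
def hcard [Fintype α] : ℕ := ∑ q : A.Q, ∑ a : α, Fintype.card (A.S q a)

/-- A DTA(NFA) is an NTA(NFA) that is deterministic. -/
def IsDTA : Prop := IsDet A.hLang

end NTAN

/-- An NTA(DFA): an unranked tree automaton whose horizontal language for each
vertical state `q` and symbol `a` is given by a complete DFA over the alphabet of
vertical states. -/
structure NTAD (α : Type) where
  Q : Type
  [finQ : Fintype Q]
  S : Q → α → Type
  [finS : ∀ q a, Fintype (S q a)]
  H : ∀ (q : Q) (a : α), DFA Q (S q a)
  F : Set Q

attribute [instance] NTAD.finQ NTAD.finS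

namespace NTAD
variable {α : Type} (A : NTAD α)

/-- Horizontal language `δ(q,a)`. -/
def hLang (q : A.Q) (a : α) : Set (List A.Q) := (A.H q a).accepts

/-- The tree language recognized. -/
def lang : Set (UTree α) := TLang A.hLang A.F

/-- Number of vertical states. -/
def vcard : ℕ := Fintype.card A.Q

/-- Number of horizontal states: `Σ_{q∈Q,σ∈Σ} |S_{q,σ}|`. -/
def hcard [Fintype α] : ℕ := ∑ q : A.Q, ∑ a : α, Fintype.card (A.S q a)

/-- A DTA(DFA) is an NTA(DFA) that is deterministic. -/
def IsDTA : Prop := IsDet A.hLang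

end NTAD

/-! ### Models with the leaf convention

Under the leaf convention, every leaf labelled `σ` is assigned a special
state `σ̄` used nowhere else: `δ(σ̄,σ) = {ε}`, `ε ∉ δ(q,σ)` for counted vertical
states `q`, and `δ(τ̄,σ) = ∅` for `τ ≠ σ`.  The full vertical state set is
`Q ⊕ α`, where only the states in `Q` (and only the horizontal automata attached
to them) are counted. -/

/-- Extension of horizontal languages (given on the counted states `Q`) to the full
state set `Q ⊕ α` by the leaf convention. -/
def leafδ {α Q : Type} (δ : Q → α → Set (List (Q ⊕ α))) :
    Q ⊕ α → α → Set (List (Q ⊕ α))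
  | Sum.inl q, a => δ q a
  | Sum.inr τ, a => {w | τ = a ∧ w = []}

/-- An SDTA observing the leaf convention. -/
structure CSDTA (α : Type) where
  Q : Type
  [finQ : Fintype Q]
  S : α → Type
  [finS : ∀ a, Fintype (S a)]
  start : ∀ a : α, S a
  step : ∀ a : α, S a → Q ⊕ α → S a
  hacc : ∀ a : α, Set (S a)
  out : ∀ a : α, S a → Q
  F : Set (Q ⊕ α)
  noeps : ∀ a : α, start a ∉ hacc a

attribute [instance] CSDTA.finQ CSDTA.finS

namespace CSDTA
variable {α : Type} (A : CSDTA α)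

/-- Horizontal language `δ(q,a)` for a counted vertical state `q`. -/
def hLang (q : A.Q) (a : α) : Set (List (A.Q ⊕ α)) :=
  {w | w.foldl (A.step a) (A.start a) ∈ A.hacc a ∧
       A.out a (w.foldl (A.step a) (A.start a)) = q}

/-- The tree language recognized. -/
def lang : Set (UTree α) := TLang (leafδ A.hLang) A.F

/-- Number of (counted) vertical states. -/
def vcard : ℕ := Fintype.card A.Q

/-- Number of horizontal states: `Σ_{σ∈Σ} |S_σ|`. -/
def hcard [Fintype α] : ℕ := ∑ a : α, Fintype.card (A.S a)

end CSDTA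

/-- An NTA(DFA) observing the leaf convention. -/
structure CNTAD (α : Type) where
  Q : Type
  [finQ : Fintype Q]
  S : Q → α → Type
  [finS : ∀ q a, Fintype (S q a)]
  H : ∀ (q : Q) (a : α), DFA (Q ⊕ α) (S q a)
  F : Set (Q ⊕ α)
  noeps : ∀ (q : Q) (a : α), [] ∉ (H q a).accepts

attribute [instance] CNTAD.finQ CNTAD.finS

namespace CNTAD
variable {α : Type} (A : CNTAD α)

/-- Horizontal language `δ(q,a)` for a counted vertical state `q`. -/
def hLang (q : A.Q) (a : α) : Set (List (A.Q ⊕ α)) := (A.H q a).accepts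

/-- The tree language recognized. -/
def lang : Set (UTree α) := TLang (leafδ A.hLang) A.F

/-- Number of (counted) vertical states. -/
def vcard : ℕ := Fintype.card A.Q

/-- Number of horizontal states: `Σ_{q∈Q,σ∈Σ} |S_{q,σ}|`. -/
def hcard [Fintype α] : ℕ := ∑ q : A.Q, ∑ a : α, Fintype.card (A.S q a)

/-- A DTA(DFA) with the leaf convention is a CNTAD that is deterministic. -/
def IsDTA : Prop := IsDet A.hLang

end CNTAD

/-- An NTA(NFA) observing the leaf convention. -/
structure CNTAN (α : Type) where
  Q : Type
  [finQ : Fintype Q]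
  S : Q → α → Type
  [finS : ∀ q a, Fintype (S q a)]
  H : ∀ (q : Q) (a : α), NFA (Q ⊕ α) (S q a)
  F : Set (Q ⊕ α)
  noeps : ∀ (q : Q) (a : α), [] ∉ (H q a).accepts

attribute [instance] CNTAN.finQ CNTAN.finS

namespace CNTAN
variable {α : Type} (A : CNTAN α)

/-- Horizontal language `δ(q,a)` for a counted vertical state `q`. -/
def hLang (q : A.Q) (a : α) : Set (List (A.Q ⊕ α)) := (A.H q a).accepts

/-- The tree language recognized. -/
def lang : Set (UTree α) := TLang (leafδ A.hLang) A.F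

/-- Number of (counted) vertical states. -/
def vcard : ℕ := Fintype.card A.Q

/-- Number of horizontal states: `Σ_{q∈Q,σ∈Σ} |S_{q,σ}|`. -/
def hcard [Fintype α] : ℕ := ∑ q : A.Q, ∑ a : α, Fintype.card (A.S q a)

/-- A DTA(NFA) with the leaf convention is a CNTAN that is deterministic. -/
def IsDTA : Prop := IsDet A.hLang

end CNTAN


theorem TReach.node_iff {α Q : Type} {δ : Q → α → Set (List Q)} {a : α} {ts : List (UTree α)}
    {q : Q} : TReach δ (UTree.node a ts) q ↔ ∃ qs ∈ δ q a, List.Forall₂ (TReach δ) ts qs := by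
  constructor
  · rintro ⟨hlen, hchild, hq⟩
    exact ⟨_, hq, List.forall₂_iff_get.2 ⟨hlen, fun i hi _ => hchild ⟨i, hi⟩⟩⟩
  · rintro ⟨qs, hq, h⟩
    obtain ⟨hlen, hchild⟩ := List.forall₂_iff_get.1 h
    exact .node hlen (fun i => hchild i i.2 (hlen ▸ i.2)) hq

namespace NTAN

open scoped Classical

variable {α : Type} (A : NTAN α)

/-- The horizontal DFA of the subset construction: it runs all NFAs `A.H q a` in parallel on
words of sets of vertical states, and accepts when the set of those `q` whose NFA accepts
is exactly `P`. -/
def parallelDFA (P : Set A.Q) (a : α) : DFA (Set A.Q) (∀ q : A.Q, Set (A.S q a)) where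
  step f X q := ⋃ p ∈ X, (A.H q a).stepSet (f q) p
  start q := (A.H q a).start
  accept := {f | {q | ∃ s ∈ f q, s ∈ (A.H q a).accept} = P}

/-- The horizontal languages of the subset construction. -/
def subsetLang (P : Set A.Q) (a : α) : Set (List (Set A.Q)) := (A.parallelDFA P a).accepts

/-- The subset construction. -/
noncomputable def determinize : NTAD α where
  Q := Set A.Q
  S _ a := ∀ q : A.Q, Set (A.S q a)
  H := A.parallelDFA
  F := {P | ∃ q ∈ A.F, q ∈ P}

/-- The set of vertical states reachable at the root of `t`. -/
def reachSet (t : UTree α) : Set A.Q := {q | TReach A.hLang t q}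

theorem mem_parallelDFA_evalFrom {P : Set A.Q} {a : α} (Xs : List (Set A.Q))
    (f : ∀ q : A.Q, Set (A.S q a)) (q : A.Q) (s : A.S q a) :
    s ∈ (A.parallelDFA P a).evalFrom f Xs q ↔
      ∃ qs, List.Forall₂ (fun X p => p ∈ X) Xs qs ∧ s ∈ (A.H q a).evalFrom (f q) qs := by
  induction Xs generalizing f with
  | nil => simp
  | cons X Xs ih =>
    rw [DFA.evalFrom_cons, ih]
    simp only [parallelDFA, NFA.evalFrom_iUnion₂, Set.mem_iUnion, List.forall₂_cons_left_iff]
    constructor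
    · rintro ⟨qs, h, p, hp, hs⟩
      exact ⟨p :: qs, ⟨p, qs, hp, h, rfl⟩, hs⟩
    · rintro ⟨_, ⟨p, qs, hp, h, rfl⟩, hs⟩
      exact ⟨qs, h, p, hp, hs⟩

theorem mem_subsetLang {P : Set A.Q} {a : α} {Xs : List (Set A.Q)} :
    Xs ∈ A.subsetLang P a ↔
      {q | ∃ qs ∈ A.hLang q a, List.Forall₂ (fun X p => p ∈ X) Xs qs} = P := by
  have key : {q | ∃ qs ∈ A.hLang q a, List.Forall₂ (fun X p => p ∈ X) Xs qs} =
      {q | ∃ s ∈ (A.parallelDFA P a).eval Xs q, s ∈ (A.H q a).accept} := by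
    ext q
    constructor
    · rintro ⟨qs, ⟨s, hacc, hs⟩, h⟩
      exact ⟨s, (A.mem_parallelDFA_evalFrom Xs _ q s).2 ⟨qs, h, hs⟩, hacc⟩
    · rintro ⟨s, hs, hacc⟩
      obtain ⟨qs, h, hs⟩ := (A.mem_parallelDFA_evalFrom Xs _ q s).1 hs
      exact ⟨qs, ⟨s, hacc, hs⟩, h⟩
  rw [key]
  rfl

theorem determinize_isDTA : A.determinize.IsDTA := by
  intro a P₁ P₂ hne
  refine Set.eq_empty_of_forall_notMem fun Xs h => hne ?_
  exact (A.mem_subsetLang.1 h.1).symm.trans (A.mem_subsetLang.1 h.2)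

theorem treach_subsetLang (t : UTree α) (P : Set A.Q) :
    TReach A.subsetLang t P ↔ A.reachSet t = P := by
  match t with
  | .node a ts =>
    have ih : ∀ t ∈ ts, ∀ P : Set A.Q, TReach A.subsetLang t P ↔ A.reachSet t = P :=
      fun t _ P => treach_subsetLang t P
    have children : ∀ Xs : List (Set A.Q),
        List.Forall₂ (TReach A.subsetLang) ts Xs ↔ ts.map A.reachSet = Xs := by
      clear P
      induction ts with
      | nil => intro Xs; cases Xs <;> simp
      | cons t ts ihts =>
        intro Xs
        cases Xs with
        | nil => simp
        | cons X Xs =>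
          rw [List.map_cons, List.cons.injEq, ← ih t (by simp),
            ← ihts fun t ht => ih t (by simp [ht])]
          exact List.forall₂_cons
    have reach : A.reachSet (.node a ts) = {q | ∃ qs ∈ A.hLang q a,
        List.Forall₂ (fun X p => p ∈ X) (ts.map A.reachSet) qs} := by
      ext q
      simp only [reachSet, Set.mem_ofPred_eq, TReach.node_iff, List.forall₂_map_left_iff]
    rw [TReach.node_iff, reach, ← A.mem_subsetLang]
    constructor
    · rintro ⟨Xs, hXs, h⟩
      rwa [(children Xs).1 h]
    · exact fun h => ⟨_, h, (children _).2 rfl⟩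
termination_by t

theorem determinize_lang : A.determinize.lang = A.lang := by
  ext t
  constructor
  · rintro ⟨P, ⟨q, hq, hqP⟩, h⟩
    rw [← (A.treach_subsetLang t P).1 h] at hqP
    exact ⟨q, hq, hqP⟩
  · rintro ⟨q, hq, h⟩
    exact ⟨A.reachSet t, ⟨q, hq, h⟩, (A.treach_subsetLang t _).2 rfl⟩

theorem determinize_vcard : A.determinize.vcard = 2 ^ A.vcard :=
  Fintype.card_set

theorem determinize_hcard [Fintype α] : A.determinize.hcard =
    2 ^ A.vcard * ∑ a : α, 2 ^ (∑ q : A.Q, Fintype.card (A.S q a)) := by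
  have card (a : α) : Fintype.card (∀ q : A.Q, Set (A.S q a)) =
      2 ^ (∑ q : A.Q, Fintype.card (A.S q a)) := by
    simp only [Fintype.card_pi, Fintype.card_set, Finset.prod_pow_eq_pow_sum]
  calc A.determinize.hcard
      = ∑ _P : Set A.Q, ∑ a : α, Fintype.card (∀ q : A.Q, Set (A.S q a)) := rfl
    _ = _ := by
      simp only [card, Finset.sum_const, Finset.card_univ, smul_eq_mul, Fintype.card_set, vcard]

end NTAN

/-- every NTA(NFA) `A` has an equivalent DTA(DFA) with at most
`2^{|Q|}` vertical states and at most `2^{|Q|} · Σ_σ 2^{Σ_q m_{q,σ}}`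
horizontal states. -/
theorem statement13 (α : Type) [Fintype α] (A : NTAN α) :
    ∃ B : NTAD α, B.IsDTA ∧ B.lang = A.lang ∧
      B.vcard ≤ 2 ^ A.vcard ∧
      B.hcard ≤ 2 ^ A.vcard * ∑ a : α, 2 ^ (∑ q : A.Q, Fintype.card (A.S q a)) := by
  exact ⟨A.determinize, A.determinize_isDTA, A.determinize_lang, A.determinize_vcard.le,
    A.determinize_hcard.le⟩
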